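/- arXiv:1812.07924 — 5 statements merged into one kernel-verified Lean document; each statement's English description precedes it below -/
import Mathlib

section
/- Let I ⊊ {1,…,n} be a proper subset and let i_1,…,i_k and i'_1,…,i'_k be two acceptable orders on I. Then s_{i_1} s_{i_2} ⋯ s_{i_k} ω = s_{i'_1} s_{i'_2} ⋯ s_{i'_k} ω in W_ext; consequently the element w_I := s_{i_1} ⋯ s_{i_k} ω depends only on I and not on the chosen acceptable order. -/
/-!
STATEMENT 1: Let `I ⊊ {1,…,n}` be a proper subset and let `i_1,…,i_k` and
`i'_1,…,i'_k` be two acceptable orders on `I`.  Then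
`s_{i_1} ⋯ s_{i_k} ω = s_{i'_1} ⋯ s_{i'_k} ω` in `W_ext`; consequently
`w_I := s_{i_1} ⋯ s_{i_k} ω` depends only on `I`.  (Zero-based indexing throughout.)
-/

noncomputable section

namespace Stmt1

open Equiv

/-- The coweight lattice `Y = ℤ^n / ℤ·(1,…,1)` of `PGL_n`. -/
abbrev Ylat (n : ℕ) : Type :=
  (Fin n → ℤ) ⧸ AddSubgroup.zmultiples (1 : Fin n → ℤ)

/-- A permutation acting on `ℤ^n` by permuting coordinates. -/
def permPre (n : ℕ) (σ : Equiv.Perm (Fin n)) : (Fin n → ℤ) ≃+ (Fin n → ℤ) where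
  toFun v := v ∘ σ.symm
  invFun v := v ∘ σ
  left_inv v := by funext i; simp
  right_inv v := by funext i; simp
  map_add' v w := rfl

lemma permPre_map (n : ℕ) (σ : Equiv.Perm (Fin n)) :
    (AddSubgroup.zmultiples (1 : Fin n → ℤ)).map
        (permPre n σ : (Fin n → ℤ) →+ (Fin n → ℤ))
      = AddSubgroup.zmultiples (1 : Fin n → ℤ) := by
  ext v
  simp only [AddSubgroup.mem_map, AddSubgroup.mem_zmultiples_iff]
  constructor
  · rintro ⟨w, ⟨c, rfl⟩, rfl⟩
    exact ⟨c, by funext i; simp [permPre]⟩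
  · rintro ⟨c, rfl⟩
    exact ⟨c • 1, ⟨c, rfl⟩, by funext i; simp [permPre]⟩

/-- The induced action of a permutation on `Y`. -/
def permAut (n : ℕ) (σ : Equiv.Perm (Fin n)) : Ylat n ≃+ Ylat n :=
  QuotientAddGroup.congr _ _ (permPre n σ) (permPre_map n σ)

lemma permAut_one (n : ℕ) : ∀ y : Ylat n, permAut n 1 y = y := by
  intro y
  induction y using QuotientAddGroup.induction_on with
  | H v => rfl

lemma permAut_mul (n : ℕ) (σ τ : Equiv.Perm (Fin n)) :
    ∀ y : Ylat n, permAut n (σ * τ) y = permAut n σ (permAut n τ y) := by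
  intro y
  induction y using QuotientAddGroup.induction_on with
  | H v => rfl

/-- The action of `W = S_n` on `Y`, packaged for the semidirect product. -/
def phi (n : ℕ) : Equiv.Perm (Fin n) →* MulAut (Multiplicative (Ylat n)) where
  toFun σ := AddEquiv.toMultiplicative (permAut n σ)
  map_one' := MulEquiv.ext fun x => permAut_one n x
  map_mul' σ τ := MulEquiv.ext fun x => permAut_mul n σ τ x

/-- The extended affine Weyl group `W_ext = W ⋉ Y`. -/
abbrev Wext (n : ℕ) : Type :=
  SemidirectProduct (Multiplicative (Ylat n)) (Equiv.Perm (Fin n)) (phi n)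

/-- The translation `t_λ ∈ W_ext` attached to `λ ∈ Y`. -/
def tl (n : ℕ) (lam : Ylat n) : Wext n :=
  SemidirectProduct.inl (Multiplicative.ofAdd lam)

/-- `e i`: the image in `Y` of the `i`-th standard basis vector. -/
def e (n : ℕ) (i : Fin n) : Ylat n := QuotientAddGroup.mk (Pi.single i 1)

/-- The simple reflections, zero-based: for `(j : ℕ) + 1 < n`, `sgen n j` is the
adjacent transposition `s_{j+1} = (j+1, j+2)` (one-based), and `sgen n ⟨n-1⟩` is the
affine simple reflection `s_n = s_{α_0} · t_{-(e_1 - e_n)}`. -/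
def sgen (n : ℕ) (j : Fin n) : Wext n :=
  if h : (j : ℕ) + 1 < n then
    SemidirectProduct.inr (Equiv.swap j ⟨(j : ℕ) + 1, h⟩)
  else
    SemidirectProduct.inr
        (Equiv.swap ⟨0, j.pos⟩ ⟨n - 1, by have := j.pos; omega⟩) *
      tl n (-(e n ⟨0, j.pos⟩ - e n ⟨n - 1, by have := j.pos; omega⟩))

/-- `ω = s_1 s_2 ⋯ s_{n-1} t_{e_n}`, the length-zero generator. -/
def omegaEl (n : ℕ) : Wext n :=
  if h : 0 < n then
    ((List.finRange (n - 1)).map fun k : Fin (n - 1) =>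
        sgen n ⟨(k : ℕ), by have := k.isLt; omega⟩).prod *
      tl n (e n ⟨n - 1, by omega⟩)
  else 1

/-- The cyclic successor `x + 1 (mod n)` on `Fin n` (zero-based; this realizes the
paper's rule "`i+1` if `i < n`, and `1` if `i = n`" on one-based indices). -/
def csucc {n : ℕ} (x : Fin n) : Fin n :=
  ⟨((x : ℕ) + 1) % n, Nat.mod_lt _ x.pos⟩

/-- The number of failures among the cyclic chain of inequalities
`i_1 > i_2 > ⋯ > i_k > i_1` attached to a list `i_1, …, i_k`. -/
def cyclicFailures {n : ℕ} (l : List (Fin n)) : ℕ :=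
  (Finset.univ.filter fun t : Fin l.length =>
    ¬ l.get ⟨((t : ℕ) + 1) % l.length, Nat.mod_lt _ t.pos⟩ < l.get t).card

/-- `l` is an acceptable order on `I`: it enumerates `I` without repetitions, the
cyclic successor of its first entry does not belong to `I`, and exactly one of the
cyclic inequalities `i_1 > i_2 > ⋯ > i_k > i_1` is false. -/
def AcceptableOrder {n : ℕ} (I : Finset (Fin n)) (l : List (Fin n)) : Prop :=
  l.Nodup ∧ l.toFinset = I ∧
    ∀ h : l ≠ [], csucc (l.head h) ∉ I ∧ cyclicFailures l = 1

lemma permAut_e (n : ℕ) (σ : Equiv.Perm (Fin n)) (i : Fin n) :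
    permAut n σ (e n i) = e n (σ i) := by
  change (QuotientAddGroup.mk (permPre n σ (Pi.single i 1)) : Ylat n) = _
  congr 1
  funext j
  simp [permPre, Pi.single_apply, Equiv.symm_apply_eq]

lemma inr_mul_tl (n : ℕ) (σ : Equiv.Perm (Fin n)) (y : Ylat n) :
    (SemidirectProduct.inr σ : Wext n) * tl n y
      = tl n (permAut n σ y) * SemidirectProduct.inr σ := by
  have h := SemidirectProduct.inl_aut (φ := phi n) σ (Multiplicative.ofAdd y)
  rw [map_inv, eq_mul_inv_iff_mul_eq] at h
  exact h.symm

lemma commute_swap_of_disjoint {α : Type*} [DecidableEq α] {a b c d : α}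
    (hac : a ≠ c) (had : a ≠ d) (hbc : b ≠ c) (hbd : b ≠ d) :
    Commute (Equiv.swap a b) (Equiv.swap c d) := by
  refine (Equiv.Perm.disjoint_iff_eq_or_eq.2 fun x => ?_).commute
  by_cases hx : x = a ∨ x = b
  · right
    rcases hx with rfl | rfl
    · exact Equiv.swap_apply_of_ne_of_ne hac had
    · exact Equiv.swap_apply_of_ne_of_ne hbc hbd
  · push Not at hx
    exact Or.inl (Equiv.swap_apply_of_ne_of_ne hx.1 hx.2)

/-- A finite simple reflection commutes with the affine one when they are not adjacent. -/
lemma commute_sgen_affine {n : ℕ} {x y : Fin n} (hx : (x : ℕ) + 1 < n)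
    (hy : ¬ (y : ℕ) + 1 < n) (h0 : (x : ℕ) ≠ 0) (h1 : (x : ℕ) + 1 ≠ y) :
    Commute (sgen n x) (sgen n y) := by
  have hyn := y.isLt
  rw [sgen, sgen, dif_pos hx, dif_neg hy]
  refine Commute.mul_right ?_ ?_
  · refine (commute_swap_of_disjoint ?_ ?_ ?_ ?_).map SemidirectProduct.inr <;>
      simp only [ne_eq, Fin.ext_iff] <;> omega
  · rw [Commute, SemiconjBy, inr_mul_tl]
    congr 2
    rw [map_neg, map_sub, permAut_e, permAut_e, Equiv.swap_apply_of_ne_of_ne,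
      Equiv.swap_apply_of_ne_of_ne] <;>
      simp only [ne_eq, Fin.ext_iff] <;> omega

lemma csucc_val_of_lt {n : ℕ} {x : Fin n} (h : (x : ℕ) + 1 < n) :
    (csucc x : ℕ) = x + 1 := Nat.mod_eq_of_lt h

lemma csucc_val_of_not_lt {n : ℕ} {x : Fin n} (h : ¬ (x : ℕ) + 1 < n) :
    (csucc x : ℕ) = 0 := by
  have : (x : ℕ) + 1 = n := by omega
  simp [csucc, this]

/-- Simple reflections at non-adjacent nodes of the cyclic Dynkin diagram commute. -/
lemma commute_sgen {n : ℕ} {x y : Fin n} (hxy : y ≠ csucc x) (hyx : x ≠ csucc y) :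
    Commute (sgen n x) (sgen n y) := by
  rcases eq_or_ne x y with rfl | hne
  · exact Commute.refl _
  rw [ne_eq, Fin.ext_iff] at hxy hyx hne
  by_cases hx : (x : ℕ) + 1 < n <;> by_cases hy : (y : ℕ) + 1 < n
  · rw [csucc_val_of_lt hx] at hxy
    rw [csucc_val_of_lt hy] at hyx
    rw [sgen, sgen, dif_pos hx, dif_pos hy]
    refine (commute_swap_of_disjoint ?_ ?_ ?_ ?_).map SemidirectProduct.inr <;>
      simp only [ne_eq, Fin.ext_iff] <;> omega
  · rw [csucc_val_of_lt hx] at hxy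
    rw [csucc_val_of_not_lt hy] at hyx
    exact commute_sgen_affine hx hy hyx (Ne.symm hxy)
  · rw [csucc_val_of_not_lt hx] at hxy
    rw [csucc_val_of_lt hy] at hyx
    exact (commute_sgen_affine hy hx hxy (Ne.symm hyx)).symm
  · omega

/-- Two rearrangements of a word have the same product if every two letters whose order
differs between the two words commute. -/
lemma prod_map_eq_of_perm_of_pairwise {α M : Type*} [Monoid M] {f : α → M}
    {R : α → α → Prop} (hf : ∀ x y, R x y → R y x → Commute (f x) (f y)) :
    ∀ {l l' : List α}, l.Perm l' → l.Pairwise R → l'.Pairwise R →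
      (l.map f).prod = (l'.map f).prod := by
  intro l
  induction l with
  | nil =>
    intro l' hp _ _
    rw [List.nil_perm.1 hp]
  | cons a t ih =>
    intro l' hp hl hl'
    obtain ⟨p, q, rfl⟩ := List.append_of_mem (hp.subset List.mem_cons_self)
    have htp : t.Perm (p ++ q) := (hp.trans List.perm_middle).cons_inv
    rw [List.pairwise_cons] at hl
    rw [List.pairwise_append] at hl'
    have hcomm : Commute (f a) (p.map f).prod := by
      refine Commute.list_prod_right _ _ fun m hm => ?_
      obtain ⟨b, hb, rfl⟩ := List.mem_map.1 hm
      exact hf a b (hl.1 b (htp.symm.subset (List.mem_append_left q hb)))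
        (hl'.2.2 b hb a List.mem_cons_self)
    have hpq : (p ++ q).Pairwise R :=
      List.pairwise_append.2 ⟨hl'.1, (List.pairwise_cons.1 hl'.2.1).2,
        fun b hb c hc => hl'.2.2 b hb c (List.mem_cons_of_mem a hc)⟩
    rw [List.map_cons, List.prod_cons, ih htp hl.2 hpq]
    simp only [List.map_append, List.map_cons, List.prod_append, List.prod_cons]
    rw [← mul_assoc, hcomm.eq, mul_assoc]

lemma le_of_descending {f : ℕ → ℕ} {k u : ℕ}
    (hdesc : ∀ t, t + 1 < k → t ≠ u → f (t + 1) < f t) {s t : ℕ} (hst : s ≤ t)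
    (htk : t < k) (hu : ¬ (s ≤ u ∧ u < t)) : f t ≤ f s := by
  induction t, hst using Nat.le_induction with
  | base => exact le_rfl
  | succ t hst ih =>
    have h1 := ih (by omega) (by omega)
    have h2 := hdesc t htk (by omega)
    omega

/-- In an acceptable order, no entry is followed later on by its cyclic successor. -/
lemma AcceptableOrder.pairwise {n : ℕ} {I : Finset (Fin n)} {l : List (Fin n)}
    (hl : AcceptableOrder I l) : l.Pairwise fun x y => y ≠ csucc x := by
  obtain ⟨-, rfl, hl⟩ := hl
  rw [List.pairwise_iff_getElem]
  intro s t hs ht hst hy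
  have hne : l ≠ [] := List.ne_nil_of_length_pos (by omega)
  obtain ⟨hhead, hcard⟩ := hl hne
  have hpos : 0 < l.length := by omega
  have hs0 : l[s] ≠ l[0] := by
    intro h
    rw [List.head_eq_getElem, ← h, ← hy] at hhead
    exact hhead (List.mem_toFinset.2 (List.getElem_mem ht))
  obtain ⟨u, hu⟩ := Finset.card_eq_one.1 hcard
  have hfail : ∀ v : Fin l.length, v ≠ u →
      l.get ⟨((v : ℕ) + 1) % l.length, Nat.mod_lt _ v.pos⟩ < l.get v := by
    intro v hv
    by_contra hcon
    have : v ∈ ({u} : Finset (Fin l.length)) := by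
      rw [← hu]
      simpa using hcon
    exact hv (Finset.mem_singleton.1 this)
  let f : ℕ → ℕ := fun i => if h : i < l.length then (l[i] : ℕ) else 0
  have hf : ∀ i (h : i < l.length), f i = (l[i] : ℕ) := fun i h => dif_pos h
  have hdesc : ∀ v, v + 1 < l.length → v ≠ u → f (v + 1) < f v := by
    intro v hv hvu
    have h := hfail ⟨v, by omega⟩ (by simpa [Fin.ext_iff] using hvu)
    rw [hf _ hv, hf v (by omega), Fin.val_fin_lt]
    simpa [Nat.mod_eq_of_lt hv] using h
  have hwrap : l.length - 1 ≠ u → f 0 < f (l.length - 1) := by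
    intro hvu
    have h := hfail ⟨l.length - 1, by omega⟩ (by simpa [Fin.ext_iff] using hvu)
    rw [hf _ hpos, hf _ (by omega), Fin.val_fin_lt]
    simpa [Nat.sub_add_cancel hpos] using h
  have hs0' : f s ≠ f 0 := by
    rw [hf s hs, hf 0 hpos]
    exact fun h => hs0 (Fin.ext h)
  have hy' : f t = (csucc l[s] : ℕ) := by rw [hf t ht, hy]
  by_cases hx : (l[s] : ℕ) + 1 < n
  · rw [csucc_val_of_lt hx, ← hf s hs] at hy'
    have hsu : s ≤ u ∧ (u : ℕ) < t := by
      by_contra hcon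
      have := le_of_descending hdesc hst.le ht hcon
      omega
    have h1 := le_of_descending hdesc (Nat.le_sub_one_of_lt ht) (by omega) (by omega)
    have h2 := le_of_descending hdesc (Nat.zero_le s) hs (by omega)
    have h3 := hwrap (by omega)
    omega
  · rw [csucc_val_of_not_lt hx] at hy'
    have hspos : s ≠ 0 := fun h => hs0' (by rw [h])
    have hsu : s - 1 = u := by
      by_contra hcon
      have h := hdesc (s - 1) (by omega) hcon
      rw [Nat.sub_add_cancel (by omega), hf s hs, hf (s - 1) (by omega)] at h
      have := l[s - 1].isLt
      omega
    rcases Nat.lt_or_ge (t + 1) l.length with h | h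
    · have := hdesc t h (by omega)
      omega
    · obtain rfl : t = l.length - 1 := by omega
      have := hwrap (by omega)
      omega

theorem stmt_1 (n : ℕ) (hn : 2 ≤ n) (I : Finset (Fin n)) (hI : I ≠ Finset.univ)
    (l l' : List (Fin n))
    (hl : AcceptableOrder I l) (hl' : AcceptableOrder I l') :
    (l.map (sgen n)).prod * omegaEl n = (l'.map (sgen n)).prod * omegaEl n := by
  have hperm : l.Perm l' :=
    List.perm_of_nodup_nodup_toFinset_eq hl.1 hl'.1 (hl.2.1.trans hl'.2.1.symm)
  rw [prod_map_eq_of_perm_of_pairwise (fun x y => commute_sgen) hperm hl.pairwise hl'.pairwise]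

end Stmt1
end
end

section
/- The assignment I ↦ w_I is injective on proper subsets of {1,…,n}: if I, I' ⊊ {1,…,n} admit acceptable orders i_1,…,i_k and i'_1,…,i'_m respectively and s_{i_1} ⋯ s_{i_k} ω = s_{i'_1} ⋯ s_{i'_m} ω in W_ext, then I = I'. -/
/-!
STATEMENT 2: The assignment `I ↦ w_I` is injective on proper subsets of `{1,…,n}`:
if `I, I'` admit acceptable orders `i_1,…,i_k` and `i'_1,…,i'_m` respectively and
`s_{i_1} ⋯ s_{i_k} ω = s_{i'_1} ⋯ s_{i'_m} ω` in `W_ext`, then `I = I'`.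
(Zero-based indexing throughout.)
-/

noncomputable section

namespace Stmt2

open Equiv

/-- The coweight lattice `Y = ℤ^n / ℤ·(1,…,1)` of `PGL_n`. -/
abbrev Ylat (n : ℕ) : Type :=
  (Fin n → ℤ) ⧸ AddSubgroup.zmultiples (1 : Fin n → ℤ)

/-- A permutation acting on `ℤ^n` by permuting coordinates. -/
def permPre (n : ℕ) (σ : Equiv.Perm (Fin n)) : (Fin n → ℤ) ≃+ (Fin n → ℤ) where
  toFun v := v ∘ σ.symm
  invFun v := v ∘ σ
  left_inv v := by funext i; simp
  right_inv v := by funext i; simp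
  map_add' v w := rfl

lemma permPre_map (n : ℕ) (σ : Equiv.Perm (Fin n)) :
    (AddSubgroup.zmultiples (1 : Fin n → ℤ)).map
        (permPre n σ : (Fin n → ℤ) →+ (Fin n → ℤ))
      = AddSubgroup.zmultiples (1 : Fin n → ℤ) := by
  ext v
  simp only [AddSubgroup.mem_map, AddSubgroup.mem_zmultiples_iff]
  constructor
  · rintro ⟨w, ⟨c, rfl⟩, rfl⟩
    exact ⟨c, by funext i; simp [permPre]⟩
  · rintro ⟨c, rfl⟩
    exact ⟨c • 1, ⟨c, rfl⟩, by funext i; simp [permPre]⟩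

/-- The induced action of a permutation on `Y`. -/
def permAut (n : ℕ) (σ : Equiv.Perm (Fin n)) : Ylat n ≃+ Ylat n :=
  QuotientAddGroup.congr _ _ (permPre n σ) (permPre_map n σ)

lemma permAut_one (n : ℕ) : ∀ y : Ylat n, permAut n 1 y = y := by
  intro y
  induction y using QuotientAddGroup.induction_on with
  | H v => rfl

lemma permAut_mul (n : ℕ) (σ τ : Equiv.Perm (Fin n)) :
    ∀ y : Ylat n, permAut n (σ * τ) y = permAut n σ (permAut n τ y) := by
  intro y
  induction y using QuotientAddGroup.induction_on with
  | H v => rfl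

/-- The action of `W = S_n` on `Y`, packaged for the semidirect product. -/
def phi (n : ℕ) : Equiv.Perm (Fin n) →* MulAut (Multiplicative (Ylat n)) where
  toFun σ := AddEquiv.toMultiplicative (permAut n σ)
  map_one' := MulEquiv.ext fun x => permAut_one n x
  map_mul' σ τ := MulEquiv.ext fun x => permAut_mul n σ τ x

/-- The extended affine Weyl group `W_ext = W ⋉ Y`. -/
abbrev Wext (n : ℕ) : Type :=
  SemidirectProduct (Multiplicative (Ylat n)) (Equiv.Perm (Fin n)) (phi n)

/-- The translation `t_λ ∈ W_ext` attached to `λ ∈ Y`. -/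
def tl (n : ℕ) (lam : Ylat n) : Wext n :=
  SemidirectProduct.inl (Multiplicative.ofAdd lam)

/-- `e i`: the image in `Y` of the `i`-th standard basis vector. -/
def e (n : ℕ) (i : Fin n) : Ylat n := QuotientAddGroup.mk (Pi.single i 1)

/-- The simple reflections, zero-based: for `(j : ℕ) + 1 < n`, `sgen n j` is the
adjacent transposition `s_{j+1} = (j+1, j+2)` (one-based), and `sgen n ⟨n-1⟩` is the
affine simple reflection `s_n = s_{α_0} · t_{-(e_1 - e_n)}`. -/
def sgen (n : ℕ) (j : Fin n) : Wext n :=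
  if h : (j : ℕ) + 1 < n then
    SemidirectProduct.inr (Equiv.swap j ⟨(j : ℕ) + 1, h⟩)
  else
    SemidirectProduct.inr
        (Equiv.swap ⟨0, j.pos⟩ ⟨n - 1, by have := j.pos; omega⟩) *
      tl n (-(e n ⟨0, j.pos⟩ - e n ⟨n - 1, by have := j.pos; omega⟩))

/-- `ω = s_1 s_2 ⋯ s_{n-1} t_{e_n}`, the length-zero generator. -/
def omegaEl (n : ℕ) : Wext n :=
  if h : 0 < n then
    ((List.finRange (n - 1)).map fun k : Fin (n - 1) =>
        sgen n ⟨(k : ℕ), by have := k.isLt; omega⟩).prod *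
      tl n (e n ⟨n - 1, by omega⟩)
  else 1

/-- The cyclic successor `x + 1 (mod n)` on `Fin n` (zero-based; this realizes the
paper's rule "`i+1` if `i < n`, and `1` if `i = n`" on one-based indices). -/
def csucc {n : ℕ} (x : Fin n) : Fin n :=
  ⟨((x : ℕ) + 1) % n, Nat.mod_lt _ x.pos⟩

/-- The number of failures among the cyclic chain of inequalities
`i_1 > i_2 > ⋯ > i_k > i_1` attached to a list `i_1, …, i_k`. -/
def cyclicFailures {n : ℕ} (l : List (Fin n)) : ℕ :=
  (Finset.univ.filter fun t : Fin l.length =>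
    ¬ l.get ⟨((t : ℕ) + 1) % l.length, Nat.mod_lt _ t.pos⟩ < l.get t).card

/-- `l` is an acceptable order on `I`: it enumerates `I` without repetitions, the
cyclic successor of its first entry does not belong to `I`, and exactly one of the
cyclic inequalities `i_1 > i_2 > ⋯ > i_k > i_1` is false. -/
def AcceptableOrder {n : ℕ} (I : Finset (Fin n)) (l : List (Fin n)) : Prop :=
  l.Nodup ∧ l.toFinset = I ∧
    ∀ h : l ≠ [], csucc (l.head h) ∉ I ∧ cyclicFailures l = 1

/-- The affine action of `W_ext` on `Y`: `t_λ σ` sends `y` to `λ + σ y`. -/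
def affineAct {n : ℕ} (w : Wext n) (y : Ylat n) : Ylat n :=
  w.left.toAdd + permAut n w.right y

lemma affineAct_one {n : ℕ} (y : Ylat n) : affineAct (1 : Wext n) y = y := by
  simp [affineAct, permAut_one]

lemma affineAct_mul {n : ℕ} (w w' : Wext n) (y : Ylat n) :
    affineAct (w * w') y = affineAct w (affineAct w' y) := by
  simp only [affineAct, SemidirectProduct.mul_left, SemidirectProduct.mul_right, permAut_mul,
    map_add, toAdd_mul, add_assoc]
  rfl

lemma affineAct_injective {n : ℕ} (w : Wext n) : Function.Injective (affineAct w) := by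
  intro y z h
  simpa [← affineAct_mul, affineAct_one] using congrArg (affineAct w⁻¹) h

/-- The alcove vertex opposite to the wall of the `i`-th simple reflection: the image in `Y` of
the indicator function of `{0, …, i}`. -/
def alcoveVertex {n : ℕ} (i : Fin n) : Ylat n :=
  QuotientAddGroup.mk fun k => if k ≤ i then 1 else 0

lemma affineAct_sgen_of_lt {n : ℕ} (j : Fin n) (h : (j : ℕ) + 1 < n) (v : Fin n → ℤ) :
    affineAct (sgen n j) (QuotientAddGroup.mk v) =
      QuotientAddGroup.mk (v ∘ Equiv.swap j ⟨(j : ℕ) + 1, h⟩) := by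
  rw [sgen, dif_pos h, affineAct, SemidirectProduct.left_inr, SemidirectProduct.right_inr,
    toAdd_one, zero_add]
  rfl

lemma affineAct_sgen_of_not_lt {n : ℕ} (j : Fin n) (h : ¬ (j : ℕ) + 1 < n) (v : Fin n → ℤ) :
    affineAct (sgen n j) (QuotientAddGroup.mk v) =
      QuotientAddGroup.mk
        ((-(Pi.single ⟨0, j.pos⟩ 1 - Pi.single ⟨n - 1, by have := j.pos; omega⟩ 1) + v) ∘
          Equiv.swap (⟨0, j.pos⟩ : Fin n) ⟨n - 1, by have := j.pos; omega⟩) := by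
  rw [sgen, dif_neg h, affineAct_mul]
  simp only [affineAct, tl, SemidirectProduct.left_inr, SemidirectProduct.right_inr,
    SemidirectProduct.left_inl, SemidirectProduct.right_inl, toAdd_one, zero_add, permAut_one]
  rfl

lemma affineAct_sgen_alcoveVertex_of_ne {n : ℕ} {i j : Fin n} (hij : j ≠ i) :
    affineAct (sgen n j) (alcoveVertex i) = alcoveVertex i := by
  have hv : (j : ℕ) ≠ i := fun h => hij (Fin.ext h)
  unfold alcoveVertex
  by_cases h : (j : ℕ) + 1 < n
  · rw [affineAct_sgen_of_lt j h]
    congr 1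
    funext k
    simp only [Function.comp_apply, Equiv.swap_apply_def, Fin.le_def, Fin.ext_iff]
    grind
  · rw [affineAct_sgen_of_not_lt j h]
    congr 1
    funext k
    have := k.isLt
    have := i.isLt
    have := j.isLt
    simp only [Function.comp_apply, Equiv.swap_apply_def, Fin.le_def, Fin.ext_iff, Pi.add_apply,
      Pi.neg_apply, Pi.sub_apply, Pi.single_apply]
    grind

lemma mk_ne_mk_of_apply_sub_ne {n : ℕ} {v w : Fin n → ℤ} (a b : Fin n)
    (h : v a - w a ≠ v b - w b) :
    (QuotientAddGroup.mk v : Ylat n) ≠ QuotientAddGroup.mk w := by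
  intro hvw
  obtain ⟨c, hc⟩ := AddSubgroup.mem_zmultiples_iff.mp (QuotientAddGroup.eq.mp hvw)
  have ha := congrFun hc a
  have hb := congrFun hc b
  simp at ha hb
  omega

lemma affineAct_sgen_alcoveVertex_self_ne {n : ℕ} (hn : 2 ≤ n) (i : Fin n) :
    affineAct (sgen n i) (alcoveVertex i) ≠ alcoveVertex i := by
  have := i.isLt
  unfold alcoveVertex
  by_cases h : (i : ℕ) + 1 < n
  · rw [affineAct_sgen_of_lt i h]
    apply mk_ne_mk_of_apply_sub_ne i ⟨i + 1, h⟩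
    simp only [Function.comp_apply, Equiv.swap_apply_left, Equiv.swap_apply_right, Fin.le_def]
    grind
  · rw [affineAct_sgen_of_not_lt i h]
    apply mk_ne_mk_of_apply_sub_ne ⟨0, by omega⟩ ⟨n - 1, by omega⟩
    simp only [Function.comp_apply, Equiv.swap_apply_left, Equiv.swap_apply_right, Fin.le_def,
      Fin.ext_iff, Pi.add_apply, Pi.neg_apply, Pi.sub_apply, Pi.single_apply]
    grind

lemma affineAct_prod_alcoveVertex_of_notMem {n : ℕ} {i : Fin n} {l : List (Fin n)}
    (hi : i ∉ l) : affineAct (l.map (sgen n)).prod (alcoveVertex i) = alcoveVertex i := by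
  induction l with
  | nil => exact affineAct_one _
  | cons j l ih =>
    rw [List.mem_cons, not_or] at hi
    rw [List.map_cons, List.prod_cons, affineAct_mul, ih hi.2,
      affineAct_sgen_alcoveVertex_of_ne (Ne.symm hi.1)]

/-- A product of distinct simple reflections fixes the `i`-th vertex of the alcove exactly when
the `i`-th reflection does not occur in it. -/
lemma affineAct_prod_alcoveVertex_eq_iff {n : ℕ} (hn : 2 ≤ n) {i : Fin n} {l : List (Fin n)}
    (hl : l.Nodup) :
    affineAct (l.map (sgen n)).prod (alcoveVertex i) = alcoveVertex i ↔ i ∉ l := by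
  refine ⟨fun h hi => ?_, affineAct_prod_alcoveVertex_of_notMem⟩
  obtain ⟨a, b, rfl⟩ := List.append_of_mem hi
  have hi' : i ∉ a ++ b := (List.nodup_cons.mp (List.nodup_middle.mp hl)).1
  rw [List.mem_append, not_or] at hi'
  rw [List.map_append, List.map_cons, List.prod_append, List.prod_cons, affineAct_mul,
    affineAct_mul, affineAct_prod_alcoveVertex_of_notMem hi'.2] at h
  exact affineAct_sgen_alcoveVertex_self_ne hn i <| affineAct_injective _ <|
    h.trans (affineAct_prod_alcoveVertex_of_notMem hi'.1).symm

theorem stmt_2 (n : ℕ) (hn : 2 ≤ n) (I I' : Finset (Fin n))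
    (hI : I ≠ Finset.univ) (hI' : I' ≠ Finset.univ)
    (l l' : List (Fin n))
    (hl : AcceptableOrder I l) (hl' : AcceptableOrder I' l')
    (heq : (l.map (sgen n)).prod * omegaEl n = (l'.map (sgen n)).prod * omegaEl n) :
    I = I' := by
  have h := mul_right_cancel heq
  obtain ⟨hnd, rfl, -⟩ := hl
  obtain ⟨hnd', rfl, -⟩ := hl'
  ext i
  rw [List.mem_toFinset, List.mem_toFinset, ← not_iff_not,
    ← affineAct_prod_alcoveVertex_eq_iff hn hnd, ← affineAct_prod_alcoveVertex_eq_iff hn hnd', h]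

end Stmt2
end
end

section
/- The map u takes values in U ⊆ Gr̄ (that is, for every x ∈ ℂ^n the tuple u(x) satisfies the incidence conditions g_i(x_1⋯x_n)(u_i(x)) ⊆ u_{i+1}(x) for 1 ≤ i ≤ n−1 and g_n(x_1⋯x_n)(u_n(x)) ⊆ u_1(x), together with the nonvanishing conditions defining U), and u : ℂ^n → U is a bijection with inverse v: v(u(x)) = x for all x ∈ ℂ^n, and u(v(z)) = z for all z ∈ U. -/
/-!
STATEMENT 3: The map `u : ℂ^n → Gr̄` built from the cyclic products `p_{j,k}` takes
values in the open set `U` (incidence plus nonvanishing conditions), and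
`u : ℂ^n → U` is a bijection with inverse `v`: `v(u(x)) = x` and `u(v(z)) = z`.
-/

noncomputable section

namespace Stmt3

open Submodule

/-- `ℙ^{n−1}`: the set of lines (1-dimensional linear subspaces) of `ℂ^n`. -/
def ProjP (n : ℕ) : Type :=
  {L : Submodule ℂ (Fin n → ℂ) // Module.finrank ℂ L = 1}

/-- The cyclic successor `i ↦ i+1 (mod n)` on `Fin n`. -/
def csucc {n : ℕ} (i : Fin n) : Fin n :=
  ⟨((i : ℕ) + 1) % n, Nat.mod_lt _ i.pos⟩

/-- `g_i(y)`: the diagonal linear map with `y` in the `i`-th diagonal entry and `1`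
elsewhere. -/
def gmap (n : ℕ) (i : Fin n) (y : ℂ) : (Fin n → ℂ) →ₗ[ℂ] (Fin n → ℂ) where
  toFun v := fun j => if j = i then y * v j else v j
  map_add' v w := by
    funext j
    by_cases h : j = i <;> simp [h] <;> ring
  map_smul' c v := by
    funext j
    by_cases h : j = i <;> simp [h] <;> ring

/-- The global Schubert variety (standard local model)
`Gr̄ = {(y, L_1,…,L_n) : g_i(y)(L_i) ⊆ L_{i+1} (cyclically)}`,
with the lines indexed zero-based (`L i` is the paper's `L_{i+1}`). -/
def GrBar (n : ℕ) : Set (ℂ × (Fin n → ProjP n)) :=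
  {z | ∀ i : Fin n, (z.2 i).1.map (gmap n i z.1) ≤ (z.2 (csucc i)).1}

/-- `p_{j,k}` (zero-based indices): `1` if `k − j ≡ −1 (mod n)`, and otherwise the
product `x_j x_{j+1} ⋯ x_k` taken cyclically. -/
def pjk (n : ℕ) (j k : Fin n) (x : Fin n → ℂ) : ℂ :=
  if ((k : ℕ) + n - (j : ℕ)) % n = n - 1 then 1
  else ∏ t ∈ Finset.range (((k : ℕ) + n - (j : ℕ)) % n + 1),
    x ⟨((j : ℕ) + t) % n, Nat.mod_lt _ j.pos⟩

/-- The spanning vector `(p_{k,n}, p_{k,1}, p_{k,2}, …, p_{k,n−1})` of the line `u_k(x)`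
(zero-based: the `m`-th coordinate is `p_{k, m-1 (mod n)}`); its `k`-th coordinate
is `1`. -/
def uvec (n : ℕ) (k : Fin n) (x : Fin n → ℂ) : Fin n → ℂ := fun m =>
  pjk n k ⟨((m : ℕ) + n - 1) % n, Nat.mod_lt _ m.pos⟩ x

lemma uvec_self (n : ℕ) (k : Fin n) (x : Fin n → ℂ) : uvec n k x k = 1 := by
  have hn : 0 < n := k.pos
  have hK : (k : ℕ) < n := k.isLt
  have key : ((((k : ℕ) + n - 1) % n) + n - (k : ℕ)) % n = n - 1 := by
    rcases Nat.eq_zero_or_pos (k : ℕ) with h0 | hpos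
    · rw [h0]
      have h1 : (0 + n - 1) % n = n - 1 := by
        rw [Nat.zero_add]
        exact Nat.mod_eq_of_lt (by omega)
      rw [h1]
      have h2 : n - 1 + n - 0 = n - 1 + n := by omega
      rw [h2, Nat.add_mod_right]
      exact Nat.mod_eq_of_lt (by omega)
    · have h1 : ((k : ℕ) + n - 1) % n = (k : ℕ) - 1 := by
        have e : (k : ℕ) + n - 1 = ((k : ℕ) - 1) + n := by omega
        rw [e, Nat.add_mod_right]
        exact Nat.mod_eq_of_lt (by omega)
      rw [h1]
      have h2 : (k : ℕ) - 1 + n - (k : ℕ) = n - 1 := by omega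
      rw [h2]
      exact Nat.mod_eq_of_lt (by omega)
  unfold uvec pjk
  rw [if_pos key]

/-- The map `u : ℂ^n → ℂ × (ℙ^{n−1})^n`,
`u(x) = (x_1 ⋯ x_n, u_1(x), …, u_n(x))`. -/
def umap (n : ℕ) (x : Fin n → ℂ) : ℂ × (Fin n → ProjP n) :=
  (∏ i, x i, fun k =>
    ⟨Submodule.span ℂ {uvec n k x}, by
      have hx : uvec n k x ≠ 0 := by
        intro h
        have h1 := congrFun h k
        rw [uvec_self] at h1
        exact one_ne_zero h1
      exact finrank_span_singleton hx⟩)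

/-- The open subset `U ⊆ Gr̄` of points `(y, L_1,…,L_n)` such that for each `i`,
writing `L_i` as the span of `(a_{i1},…,a_{in})`, one has `a_{ii} ≠ 0`. -/
def Uset (n : ℕ) : Set (ℂ × (Fin n → ProjP n)) :=
  {z | z ∈ GrBar n ∧
    ∀ i : Fin n, ∃ a : Fin n → ℂ, (z.2 i).1 = Submodule.span ℂ {a} ∧ a i ≠ 0}

/-- The map `v : U → ℂ^n`,
`v(y, L_1,…,L_n) = (a_{12}/a_{11}, a_{23}/a_{22}, …, a_{n1}/a_{nn})` (independent of
the chosen spanning vectors). -/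
noncomputable def vmap (n : ℕ) (z : ℂ × (Fin n → ProjP n)) (hz : z ∈ Uset n) :
    Fin n → ℂ := fun i =>
  (hz.2 i).choose (csucc i) / (hz.2 i).choose i

/-- The `d`-fold cyclic shift `k ↦ k + d (mod n)` on `Fin n`. -/
def cshift {n : ℕ} (k : Fin n) (d : ℕ) : Fin n :=
  ⟨((k : ℕ) + d) % n, Nat.mod_lt _ k.pos⟩

lemma cshift_zero {n : ℕ} (k : Fin n) : cshift k 0 = k :=
  Fin.ext (Nat.mod_eq_of_lt k.isLt)

lemma cshift_csucc {n : ℕ} (k : Fin n) (d : ℕ) :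
    cshift (csucc k) d = cshift k (d + 1) := by
  apply Fin.ext
  simp only [cshift, csucc, Nat.mod_add_mod]
  congr 1
  omega

lemma cshift_self {n : ℕ} (k : Fin n) : cshift k n = k := by
  apply Fin.ext
  simp only [cshift, Nat.add_mod_right]
  exact Nat.mod_eq_of_lt k.isLt

lemma cshift_inj {n : ℕ} (k : Fin n) {d e : ℕ} (hd : d < n) (he : e < n)
    (h : cshift k d = cshift k e) : d = e := by
  have h1 : (k : ℕ) + d ≡ k + e [MOD n] := congrArg Fin.val h
  exact (Nat.ModEq.add_left_cancel' _ h1).eq_of_lt_of_lt hd he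

lemma cshift_bijective {n : ℕ} (k : Fin n) :
    Function.Bijective fun t : Fin n => cshift k t := by
  apply Finite.injective_iff_bijective.mp
  intro a b h
  exact Fin.ext (cshift_inj k a.isLt b.isLt h)

lemma exists_cshift {n : ℕ} (k m : Fin n) : ∃ d < n, m = cshift k d := by
  obtain ⟨t, ht⟩ := (cshift_bijective k).2 m
  exact ⟨t, t.isLt, ht.symm⟩

lemma csucc_ne_self {n : ℕ} (hn : 2 ≤ n) (i : Fin n) : csucc i ≠ i := by
  intro h
  have h1 : cshift i 1 = cshift i 0 := by rw [cshift_zero]; exact h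
  exact absurd (cshift_inj i (by omega) (by omega) h1) one_ne_zero

lemma prod_range_cshift {n : ℕ} (k : Fin n) (x : Fin n → ℂ) :
    ∏ t ∈ Finset.range n, x (cshift k t) = ∏ i, x i := by
  rw [Finset.prod_range]
  exact (cshift_bijective k).prod_comp x

lemma prod_cshift_succ {n : ℕ} (k : Fin n) (x : Fin n → ℂ) (d : ℕ) :
    ∏ t ∈ Finset.range (d + 1), x (cshift k t) =
      x k * ∏ t ∈ Finset.range d, x (cshift (csucc k) t) := by
  rw [Finset.prod_range_succ', cshift_zero, mul_comm]
  simp only [cshift_csucc]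

lemma uvec_cshift {n : ℕ} (k : Fin n) (x : Fin n → ℂ) {d : ℕ} (hd : d < n) :
    uvec n k x (cshift k d) = ∏ t ∈ Finset.range d, x (cshift k t) := by
  rcases d with _ | d
  · rw [cshift_zero, uvec_self, Finset.prod_range_zero]
  · have hk := k.isLt
    have key : ((((((k : ℕ) + (d + 1)) % n) + n - 1) % n) + n - (k : ℕ)) % n = d := by
      rcases lt_or_ge ((k : ℕ) + (d + 1)) n with h | h
      · rw [Nat.mod_eq_of_lt h,
          show (k : ℕ) + (d + 1) + n - 1 = k + d + n by omega, Nat.add_mod_right,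
          Nat.mod_eq_of_lt (show (k : ℕ) + d < n by omega),
          show (k : ℕ) + d + n - k = d + n by omega, Nat.add_mod_right,
          Nat.mod_eq_of_lt (by omega)]
      · rw [Nat.mod_eq_sub_mod h,
          Nat.mod_eq_of_lt (show (k : ℕ) + (d + 1) - n < n by omega)]
        rw [show (k : ℕ) + (d + 1) - n + n - 1 = k + d by omega]
        rcases lt_or_ge ((k : ℕ) + d) n with h' | h'
        · rw [Nat.mod_eq_of_lt h', show (k : ℕ) + d + n - k = d + n by omega,
            Nat.add_mod_right, Nat.mod_eq_of_lt (by omega)]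
        · rw [Nat.mod_eq_sub_mod h',
            Nat.mod_eq_of_lt (show (k : ℕ) + d - n < n by omega),
            show (k : ℕ) + d - n + n - k = d by omega, Nat.mod_eq_of_lt (by omega)]
    simp only [uvec, pjk, cshift, key]
    rw [if_neg (by omega)]

lemma uvec_csucc {n : ℕ} (hn : 2 ≤ n) (k : Fin n) (x : Fin n → ℂ) :
    uvec n k x (csucc k) = x k := by
  have h := uvec_cshift k x (show 1 < n by omega)
  rwa [Finset.prod_range_one, cshift_zero] at h

lemma gmap_uvec {n : ℕ} (i : Fin n) (x : Fin n → ℂ) :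
    gmap n i (∏ j, x j) (uvec n i x) = x i • uvec n (csucc i) x := by
  funext m
  obtain ⟨d, hd, rfl⟩ := exists_cshift (csucc i) m
  change (if cshift (csucc i) d = i then _ * _ else _) = x i * _
  rw [uvec_cshift _ _ hd, ← prod_cshift_succ, cshift_csucc]
  rcases (show d + 1 ≤ n by omega).eq_or_lt with h | h
  · rw [h, cshift_self, if_pos rfl, uvec_self, mul_one, prod_range_cshift]
  · rw [if_neg, uvec_cshift _ _ h]
    intro h0
    exact absurd (cshift_inj i h (by omega) (h0.trans (cshift_zero i).symm)) (by omega)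

lemma umap_mem_Uset (n : ℕ) (x : Fin n → ℂ) : umap n x ∈ Uset n := by
  refine ⟨fun i => ?_, fun i => ⟨uvec n i x, rfl, by simp [uvec_self]⟩⟩
  change (span ℂ {uvec n i x}).map (gmap n i (∏ j, x j)) ≤ span ℂ {uvec n (csucc i) x}
  rw [map_span, Set.image_singleton, gmap_uvec, span_singleton_le_iff_mem]
  exact smul_mem _ _ (mem_span_singleton_self _)

lemma vmap_umap {n : ℕ} (hn : 2 ≤ n) (x : Fin n → ℂ) (h : umap n x ∈ Uset n) :
    vmap n (umap n x) h = x := by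
  funext i
  obtain ⟨hspan, hne⟩ := (h.2 i).choose_spec
  change _ / _ = _
  set a := (h.2 i).choose
  have ha : a ∈ span ℂ {uvec n i x} := by
    change span ℂ {uvec n i x} = span ℂ {a} at hspan
    rw [hspan]
    exact mem_span_singleton_self a
  obtain ⟨c, hc⟩ := mem_span_singleton.mp ha
  have hi : a i = c := by rw [← hc, Pi.smul_apply, uvec_self, smul_eq_mul, mul_one]
  rw [div_eq_iff hne, hi, ← hc, Pi.smul_apply, uvec_csucc hn, smul_eq_mul, mul_comm]

/-- Vectors normalised at their own index and satisfying the incidence conditions of `GrBar`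
are given by the cyclic products of `uvec`. -/
lemma eq_uvec_of_incidence {n : ℕ} (b : Fin n → Fin n → ℂ) (x : Fin n → ℂ)
    (hb : ∀ i, b i i = 1) (hrec : ∀ i m, m ≠ i → b i m = x i * b (csucc i) m) (i : Fin n) :
    b i = uvec n i x := by
  have key : ∀ d < n, ∀ i, b i (cshift i d) = ∏ t ∈ Finset.range d, x (cshift i t) := by
    intro d
    induction d with
    | zero => intro _ i; rw [cshift_zero, hb, Finset.prod_range_zero]
    | succ d ih =>
      intro hd i
      rw [prod_cshift_succ, ← ih (by omega) (csucc i), cshift_csucc]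
      apply hrec
      intro h
      exact absurd (cshift_inj i hd (by omega) (h.trans (cshift_zero i).symm)) (by omega)
  funext m
  obtain ⟨d, hd, rfl⟩ := exists_cshift i m
  rw [key d hd, uvec_cshift i x hd]

lemma umap_vmap {n : ℕ} (hn : 2 ≤ n) (z : ℂ × (Fin n → ProjP n)) (hz : z ∈ Uset n) :
    umap n (vmap n z hz) = z := by
  set x := vmap n z hz with hx
  have hex : ∀ i, ∃ b : Fin n → ℂ, (z.2 i).1 = span ℂ {b} ∧ b i = 1 ∧ b (csucc i) = x i := by
    intro i
    obtain ⟨hspan, hne⟩ := (hz.2 i).choose_spec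
    refine ⟨((hz.2 i).choose i)⁻¹ • (hz.2 i).choose, ?_, ?_, ?_⟩
    · rw [span_singleton_smul_eq (inv_ne_zero hne).isUnit]
      exact hspan
    · exact inv_mul_cancel₀ hne
    · exact (div_eq_inv_mul _ _).symm
  choose b hspan hb hbx using hex
  have hg : ∀ i, gmap n i z.1 (b i) = x i • b (csucc i) := by
    intro i
    have hmem : gmap n i z.1 (b i) ∈ span ℂ {b (csucc i)} := by
      rw [← hspan (csucc i)]
      apply hz.1 i
      apply mem_map_of_mem
      rw [hspan i]
      exact mem_span_singleton_self _
    obtain ⟨c, hc⟩ := mem_span_singleton.mp hmem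
    have h1 := congrFun hc (csucc i)
    simp only [gmap, LinearMap.coe_mk, AddHom.coe_mk, Pi.smul_apply, smul_eq_mul, hb, hbx,
      if_neg (csucc_ne_self hn i), mul_one] at h1
    rw [← hc, h1]
  have hbu : ∀ i, b i = uvec n i x := by
    apply eq_uvec_of_incidence b x hb
    intro i m hm
    have h := congrFun (hg i) m
    simpa only [gmap, LinearMap.coe_mk, AddHom.coe_mk, Pi.smul_apply, smul_eq_mul,
      if_neg hm] using h
  apply Prod.ext
  · let i : Fin n := ⟨0, by omega⟩
    have h := congrFun (hg i) i
    have h' := congrFun (gmap_uvec i x) i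
    rw [hbu (csucc i), ← h'] at h
    simp only [gmap, LinearMap.coe_mk, AddHom.coe_mk, if_pos, hb, uvec_self, mul_one] at h
    exact h.symm
  · funext i
    apply Subtype.ext
    change span ℂ {uvec n i x} = _
    rw [hspan i, hbu i]

theorem stmt_3 (n : ℕ) (hn : 2 ≤ n) :
    ∃ hmem : ∀ x : Fin n → ℂ, umap n x ∈ Uset n,
      (∀ x : Fin n → ℂ, vmap n (umap n x) (hmem x) = x) ∧
      (∀ z : ℂ × (Fin n → ProjP n), ∀ hz : z ∈ Uset n, umap n (vmap n z hz) = z) := by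
  exact ⟨umap_mem_Uset n, fun x => vmap_umap hn x _, umap_vmap hn⟩

end Stmt3
end
end

section
/- For every y ∈ ℂ with y ≠ 0, the map f^{-1}(y) → ℙ^{n−1} sending (y, L_1,…,L_n) to L_1 is a bijection. More precisely, for every line L ∈ ℙ^{n−1} there is a unique point of Gr̄ with first coordinate y and second coordinate L, namely the tuple with L_1 = L and L_{i+1} = g_i(y) g_{i−1}(y) ⋯ g_1(y)(L) for 1 ≤ i ≤ n−1. -/
/-!
STATEMENT 4: For every `y ≠ 0`, the map `f⁻¹(y) → ℙ^{n−1}`, `(y, L_1,…,L_n) ↦ L_1`,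
is a bijection: for every line `L` there is a unique point of `Gr̄` with first
coordinate `y` and second coordinate `L`, namely the tuple with `L_1 = L` and
`L_{i+1} = g_i(y) ⋯ g_1(y) (L)`.
-/

noncomputable section

namespace Stmt4

open Submodule

/-- `ℙ^{n−1}`: the set of lines (1-dimensional linear subspaces) of `ℂ^n`. -/
def ProjP (n : ℕ) : Type :=
  {L : Submodule ℂ (Fin n → ℂ) // Module.finrank ℂ L = 1}

/-- The cyclic successor `i ↦ i+1 (mod n)` on `Fin n`. -/
def csucc {n : ℕ} (i : Fin n) : Fin n :=
  ⟨((i : ℕ) + 1) % n, Nat.mod_lt _ i.pos⟩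

/-- `g_i(y)`: the diagonal linear map with `y` in the `i`-th diagonal entry and `1`
elsewhere. -/
def gmap (n : ℕ) (i : Fin n) (y : ℂ) : (Fin n → ℂ) →ₗ[ℂ] (Fin n → ℂ) where
  toFun v := fun j => if j = i then y * v j else v j
  map_add' v w := by
    funext j
    by_cases h : j = i <;> simp [h] <;> ring
  map_smul' c v := by
    funext j
    by_cases h : j = i <;> simp [h] <;> ring

/-- The global Schubert variety (standard local model)
`Gr̄ = {(y, L_1,…,L_n) : g_i(y)(L_i) ⊆ L_{i+1} (cyclically)}`,
with the lines indexed zero-based (`L i` is the paper's `L_{i+1}`). -/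
def GrBar (n : ℕ) : Set (ℂ × (Fin n → ProjP n)) :=
  {z | ∀ i : Fin n, (z.2 i).1.map (gmap n i z.1) ≤ (z.2 (csucc i)).1}

/-- The composite `g_i(y) ∘ g_{i-1}(y) ∘ ⋯ ∘ g_1(y)` (in zero-based indexing, the
product of `gmap n j y` over `j = i-1, …, 0`), as an element of `End(ℂ^n)`. -/
def gcomp (n : ℕ) (y : ℂ) (i : Fin n) : Module.End ℂ (Fin n → ℂ) :=
  ((((List.finRange n).take (i : ℕ)).reverse).map fun j => gmap n j y).prod

theorem gmap_apply (n : ℕ) (i : Fin n) (y : ℂ) (v : Fin n → ℂ) (j : Fin n) :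
    gmap n i y v j = if j = i then y * v j else v j := rfl

/-- The composite of the first `k` maps scales exactly the first `k` coordinates by `y`. -/
theorem prod_take_gmap_apply (n : ℕ) (y : ℂ) (k : ℕ) (hk : k ≤ n) (v : Fin n → ℂ) (j : Fin n) :
    (((((List.finRange n).take k).reverse).map fun j => gmap n j y).prod :
      Module.End ℂ (Fin n → ℂ)) v j = if (j : ℕ) < k then y * v j else v j := by
  induction k with
  | zero => simp
  | succ k ih =>
    have hlen : k < (List.finRange n).length := by simpa using hk
    rw [List.take_add_one, List.getElem?_eq_getElem hlen]
    simp only [Option.toList_some, List.reverse_append, List.reverse_singleton,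
      List.singleton_append, List.map_cons, List.prod_cons, Module.End.mul_apply]
    rw [gmap_apply, ih (by omega)]
    simp only [List.getElem_finRange, Fin.ext_iff, Fin.val_cast]
    split_ifs <;> first | rfl | omega

theorem gcomp_apply (n : ℕ) (y : ℂ) (i : Fin n) (v : Fin n → ℂ) (j : Fin n) :
    gcomp n y i v j = if (j : ℕ) < (i : ℕ) then y * v j else v j :=
  prod_take_gmap_apply n y i i.isLt.le v j

theorem gmap_injective (n : ℕ) (i : Fin n) {y : ℂ} (hy : y ≠ 0) :
    Function.Injective (gmap n i y) := by
  intro v w h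
  funext j
  have hj := congrFun h j
  simp only [gmap_apply] at hj
  split_ifs at hj
  · exact mul_left_cancel₀ hy hj
  · exact hj

theorem gcomp_injective (n : ℕ) (i : Fin n) {y : ℂ} (hy : y ≠ 0) :
    Function.Injective (gcomp n y i) := by
  intro v w h
  funext j
  have hj := congrFun h j
  simp only [gcomp_apply] at hj
  split_ifs at hj
  · exact mul_left_cancel₀ hy hj
  · exact hj

theorem map_gcomp_zero (n : ℕ) (y : ℂ) (i : Fin n) (hi : (i : ℕ) = 0)
    (S : Submodule ℂ (Fin n → ℂ)) : S.map (gcomp n y i) = S := by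
  have h : gcomp n y i = LinearMap.id := by
    refine LinearMap.ext fun v => ?_
    funext j
    simp [gcomp_apply, hi]
  rw [h, Submodule.map_id]

/-- Applying the `i`-th map to the `i`-th composite image gives the next one; after the last
step the total composite is multiplication by `y`, which preserves every subspace. -/
theorem map_gmap_map_gcomp_le (n : ℕ) (y : ℂ) (i : Fin n) (S : Submodule ℂ (Fin n → ℂ)) :
    (S.map (gcomp n y i)).map (gmap n i y) ≤ S.map (gcomp n y (csucc i)) := by
  rintro _ ⟨_, ⟨v, hv, rfl⟩, rfl⟩
  by_cases h : (i : ℕ) + 1 < n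
  · refine ⟨v, hv, ?_⟩
    funext j
    have hc : ((csucc i : Fin n) : ℕ) = i + 1 := Nat.mod_eq_of_lt h
    simp only [gmap_apply, gcomp_apply, hc, Fin.ext_iff]
    split_ifs <;> first | rfl | omega
  · have hn : (i : ℕ) + 1 = n := by omega
    have hc : ((csucc i : Fin n) : ℕ) = 0 := by simp [csucc, hn]
    refine ⟨y • v, S.smul_mem y hv, ?_⟩
    funext j
    simp only [gmap_apply, gcomp_apply, hc, Fin.ext_iff, Pi.smul_apply, smul_eq_mul]
    split_ifs <;> first | rfl | omega

theorem finrank_map_eq_one {n : ℕ} {g : (Fin n → ℂ) →ₗ[ℂ] (Fin n → ℂ)}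
    (hg : Function.Injective g) (L : ProjP n) : Module.finrank ℂ (L.1.map g) = 1 :=
  (LinearEquiv.finrank_eq (Submodule.equivMapOfInjective g hg L.1)).symm.trans L.2

theorem map_gmap_eq_of_mem_GrBar {n : ℕ} {z : ℂ × (Fin n → ProjP n)} (hz : z ∈ GrBar n)
    (hy : z.1 ≠ 0) (i : Fin n) : (z.2 i).1.map (gmap n i z.1) = (z.2 (csucc i)).1 :=
  Submodule.eq_of_le_of_finrank_eq (hz i)
    ((finrank_map_eq_one (gmap_injective n i hy) _).trans (z.2 (csucc i)).2.symm)

theorem eq_map_gcomp_of_mem_GrBar {n : ℕ} (hn : 0 < n) {z : ℂ × (Fin n → ProjP n)}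
    (hz : z ∈ GrBar n) (hy : z.1 ≠ 0) (i : Fin n) :
    (z.2 i).1 = (z.2 ⟨0, hn⟩).1.map (gcomp n z.1 i) := by
  obtain ⟨k, hk⟩ := i
  induction k with
  | zero => rw [map_gcomp_zero _ _ _ rfl]
  | succ k ih =>
    have hc : csucc (⟨k, by omega⟩ : Fin n) = ⟨k + 1, hk⟩ := Fin.ext (Nat.mod_eq_of_lt hk)
    have hle := map_gmap_map_gcomp_le n z.1 ⟨k, by omega⟩ (z.2 ⟨0, hn⟩).1
    rw [← ih (by omega), map_gmap_eq_of_mem_GrBar hz hy, hc] at hle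
    exact Submodule.eq_of_le_of_finrank_eq hle
      ((z.2 _).2.trans (finrank_map_eq_one (gcomp_injective n _ hy) _).symm)

theorem stmt_4 (n : ℕ) (hn : 2 ≤ n) (y : ℂ) (hy : y ≠ 0) (L : ProjP n) :
    (∃! z : ℂ × (Fin n → ProjP n),
      z ∈ GrBar n ∧ z.1 = y ∧ z.2 ⟨0, by omega⟩ = L) ∧
    (∀ z : ℂ × (Fin n → ProjP n),
      (z ∈ GrBar n ∧ z.1 = y ∧ z.2 ⟨0, by omega⟩ = L) →
        ∀ i : Fin n, (z.2 i).1 = Submodule.map (gcomp n y i) L.1) := by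
  have key : ∀ z : ℂ × (Fin n → ProjP n),
      (z ∈ GrBar n ∧ z.1 = y ∧ z.2 ⟨0, by omega⟩ = L) →
        ∀ i : Fin n, (z.2 i).1 = Submodule.map (gcomp n y i) L.1 := by
    rintro z ⟨hz, rfl, rfl⟩ i
    exact eq_map_gcomp_of_mem_GrBar (by omega) hz hy i
  refine ⟨⟨(y, fun i => ⟨L.1.map (gcomp n y i), finrank_map_eq_one (gcomp_injective n i hy) L⟩),
    ⟨fun i => map_gmap_map_gcomp_le n y i L.1, rfl,
      Subtype.ext (map_gcomp_zero n y _ rfl L.1)⟩, ?_⟩, key⟩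
  intro z hz
  exact Prod.ext hz.2.1 (funext fun i => Subtype.ext (key z hz i))

end Stmt4
end
end

section
/- Let A be a module over a ring and N : A → A a nilpotent module endomorphism. Then there exists a unique increasing family (M_i)_{i∈ℤ} of submodules of A with M_{i-1} ⊆ M_i, M_i = 0 for i sufficiently small and M_i = A for i sufficiently large, such that: (1) N(M_i) ⊆ M_{i-2} for all i; and (2) for every i ≥ 0, N^i induces an isomorphism M_i/M_{i-1} ≅ M_{-i}/M_{-i-1}. -/
/-!
STATEMENT 6: Let `A` be a module over a ring and `N : A → A` a nilpotent module
endomorphism.  Then there exists a unique increasing family `(M_i)_{i ∈ ℤ}` of submodules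
of `A`, with `M_i = 0` for `i` small and `M_i = A` for `i` large, such that
`N(M_i) ⊆ M_{i-2}` for all `i` and, for every `i ≥ 0`, `N^i` induces an isomorphism
`M_i/M_{i-1} ≅ M_{-i}/M_{-i-1}` (the monodromy filtration).
-/

/-- `N^i` induces an isomorphism `F i / F (i-1) ≅ F (-i) / F (-i-1)`, stated elementwise:
`N^i` maps `F i` into `F (-i)`, the induced map is surjective modulo `F (-i-1)`, and its
"kernel" is exactly `F (i-1)`. -/
def InducesIso {R A : Type*} [Ring R] [AddCommGroup A] [Module R A]
    (N : A →ₗ[R] A) (F : ℤ → Submodule R A) (i : ℕ) : Prop :=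
  (∀ x ∈ F (i : ℤ), (N ^ i) x ∈ F (-(i : ℤ))) ∧
  (∀ y ∈ F (-(i : ℤ)), ∃ x ∈ F (i : ℤ), y - (N ^ i) x ∈ F (-(i : ℤ) - 1)) ∧
  (∀ x ∈ F (i : ℤ), (N ^ i) x ∈ F (-(i : ℤ) - 1) → x ∈ F ((i : ℤ) - 1))

/-- `F` is a finite increasing filtration with `N (F i) ≤ F (i - 2)` such that every `N ^ i`
induces an isomorphism `F i / F (i - 1) ≅ F (-i) / F (-i - 1)`. -/
structure IsMonodromyFiltration {R A : Type*} [Ring R] [AddCommGroup A] [Module R A]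
    (N : A →ₗ[R] A) (F : ℤ → Submodule R A) : Prop where
  le_succ : ∀ i : ℤ, F (i - 1) ≤ F i
  eq_bot : ∃ a : ℤ, ∀ i ≤ a, F i = ⊥
  eq_top : ∃ b : ℤ, ∀ i, b ≤ i → F i = ⊤
  map_le : ∀ i : ℤ, (F i).map N ≤ F (i - 2)
  inducesIso : ∀ i : ℕ, InducesIso N F i

namespace IsMonodromyFiltration

variable {R A : Type*} [Ring R] [AddCommGroup A] [Module R A]
  {N : A →ₗ[R] A} {F F' : ℤ → Submodule R A}

theorem monotone (hF : IsMonodromyFiltration N F) : Monotone F :=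
  monotone_int_of_le_succ fun i => by simpa using hF.le_succ (i + 1)

theorem apply_mem (hF : IsMonodromyFiltration N F) {i : ℤ} {x : A} (hx : x ∈ F i) :
    N x ∈ F (i - 2) :=
  hF.map_le i (Submodule.mem_map_of_mem hx)

theorem mem_of_pow_apply_eq_zero (hF : IsMonodromyFiltration N F) {k : ℕ} {x : A}
    (hx : (N ^ (k + 1)) x = 0) : x ∈ F k := by
  have descend : ∀ n : ℕ, x ∈ F ((k + n : ℕ) : ℤ) → x ∈ F k := by
    intro n
    induction n with
    | zero => exact id
    | succ n ih =>
      intro h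
      apply ih
      have hpow : (N ^ (k + (n + 1))) x = 0 := by
        rw [show k + (n + 1) = n + (k + 1) by omega, pow_add, Module.End.mul_apply, hx, map_zero]
      have := (hF.inducesIso (k + (n + 1))).2.2 x h (hpow ▸ zero_mem _)
      rwa [show (((k + (n + 1) : ℕ) : ℤ) - 1) = ((k + n : ℕ) : ℤ) by push_cast; ring] at this
  obtain ⟨b, hb⟩ := hF.eq_top
  apply descend b.toNat
  rw [hb _ (by omega)]
  trivial

theorem neg_eq_map_pow (hF : IsMonodromyFiltration N F) (l : ℕ) :
    F (-(l : ℤ)) = (F l).map (N ^ l) := by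
  apply le_antisymm
  · obtain ⟨a, ha⟩ := hF.eq_bot
    have ascend : ∀ n l : ℕ, -(l : ℤ) ≤ a + n → F (-(l : ℤ)) ≤ (F l).map (N ^ l) := by
      intro n
      induction n with
      | zero =>
        intro l hl
        rw [ha _ (by simpa using hl)]
        exact bot_le
      | succ n ih =>
        intro l hl y hy
        obtain ⟨x, hx, hyx⟩ := (hF.inducesIso l).2.1 y hy
        rw [show -(l : ℤ) - 1 = -((l + 1 : ℕ) : ℤ) by push_cast; ring] at hyx
        obtain ⟨w, hw, hwy⟩ := ih (l + 1) (by push_cast at hl ⊢; omega) hyx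
        refine ⟨x + N w, add_mem hx (hF.monotone ?_ (hF.apply_mem hw)), ?_⟩
        · push_cast; omega
        · rw [map_add, ← Module.End.mul_apply, ← pow_succ, hwy]
          abel
    exact ascend (-a).toNat l (by omega)
  · rintro _ ⟨x, hx, rfl⟩
    exact (hF.inducesIso l).1 x hx

theorem eq_ker_sup_map (hF : IsMonodromyFiltration N F) (l : ℕ) :
    F l = LinearMap.ker (N ^ (l + 1)) ⊔ (F ((l + 2 : ℕ) : ℤ)).map N := by
  have hmap : ∀ w ∈ F ((l + 2 : ℕ) : ℤ), N w ∈ F l := fun w hw => by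
    simpa using hF.apply_mem hw
  apply le_antisymm
  · intro x hx
    have h : N ((N ^ l) x) ∈ F (-((l + 2 : ℕ) : ℤ)) := by
      have := hF.apply_mem ((hF.inducesIso l).1 x hx)
      rwa [show -(l : ℤ) - 2 = -((l + 2 : ℕ) : ℤ) by push_cast; ring] at this
    rw [hF.neg_eq_map_pow] at h
    obtain ⟨w, hw, hwx⟩ := h
    refine Submodule.mem_sup.2 ⟨x - N w, ?_, N w, Submodule.mem_map_of_mem hw, by abel⟩
    rw [LinearMap.mem_ker, map_sub, ← Module.End.mul_apply, ← pow_succ, hwx, pow_succ',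
      Module.End.mul_apply, sub_self]
  · refine sup_le (fun x hx => hF.mem_of_pow_apply_eq_zero hx) ?_
    rintro _ ⟨w, hw, rfl⟩
    exact hmap w hw

theorem unique (hF : IsMonodromyFiltration N F) (hF' : IsMonodromyFiltration N F') :
    F = F' := by
  obtain ⟨b, hb⟩ := hF.eq_top
  obtain ⟨b', hb'⟩ := hF'.eq_top
  have descend : ∀ n l : ℕ, max b b' ≤ l + n → F l = F' l := by
    intro n
    induction n with
    | zero =>
      intro l hl
      rw [hb _ (by simp at hl; omega), hb' _ (by simp at hl; omega)]
    | succ n ih =>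
      intro l hl
      rw [hF.eq_ker_sup_map, hF'.eq_ker_sup_map, ih (l + 2) (by push_cast at hl ⊢; omega)]
  have nonneg (l : ℕ) : F l = F' l := descend (max b b').toNat l (by omega)
  funext k
  obtain ⟨l, rfl | rfl⟩ := k.eq_nat_or_neg
  · exact nonneg l
  · rw [hF.neg_eq_map_pow, hF'.neg_eq_map_pow, nonneg]

end IsMonodromyFiltration

/-- The convolution of the kernel and image filtrations of `N`: the sum over `i - j = k` of
`N ^ j (ker N ^ (i + j + 1)) = ker N ^ (i + 1) ⊓ range N ^ j`. -/
def monodromyFiltration {R A : Type*} [Ring R] [AddCommGroup A] [Module R A]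
    (N : A →ₗ[R] A) (k : ℤ) : Submodule R A :=
  ⨆ (i : ℕ) (j : ℕ) (_ : (i : ℤ) - j = k), (LinearMap.ker (N ^ (i + j + 1))).map (N ^ j)

section

variable {R A : Type*} [Ring R] [AddCommGroup A] [Module R A] {N : A →ₗ[R] A}

theorem pow_apply_mem_monodromyFiltration {i j : ℕ} {k : ℤ} (hk : (i : ℤ) - j = k) {x : A}
    (hx : (N ^ (i + j + 1)) x = 0) : (N ^ j) x ∈ monodromyFiltration N k :=
  (le_iSup_of_le i <| le_iSup_of_le j <| le_iSup_of_le hk le_rfl :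
    (LinearMap.ker (N ^ (i + j + 1))).map (N ^ j) ≤ monodromyFiltration N k)
    (Submodule.mem_map_of_mem hx)

theorem monodromyFiltration_le {k : ℤ} {S : Submodule R A}
    (h : ∀ (i j : ℕ) (x : A), (i : ℤ) - j = k → (N ^ (i + j + 1)) x = 0 → (N ^ j) x ∈ S) :
    monodromyFiltration N k ≤ S := by
  refine iSup_le fun i => iSup_le fun j => iSup_le fun hk => ?_
  rintro _ ⟨x, hx, rfl⟩
  exact h i j x hk hx

theorem map_monodromyFiltration_le (k : ℤ) :
    (monodromyFiltration N k).map N ≤ monodromyFiltration N (k - 2) := by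
  rw [Submodule.map_le_iff_le_comap]
  refine monodromyFiltration_le fun i j x hk hx => ?_
  rw [Submodule.mem_comap, ← Module.End.mul_apply, ← pow_succ']
  cases i with
  | zero =>
    rw [zero_add] at hx
    rw [hx]
    exact zero_mem _
  | succ i =>
    refine pow_apply_mem_monodromyFiltration (i := i) (by push_cast at hk ⊢; omega) ?_
    rwa [show i + (j + 1) + 1 = i + 1 + j + 1 by omega]

theorem pow_apply_mem_monodromyFiltration_sub (n : ℕ) {k : ℤ} {x : A}
    (hx : x ∈ monodromyFiltration N k) :
    (N ^ n) x ∈ monodromyFiltration N (k - 2 * n) := by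
  induction n with
  | zero => simpa using hx
  | succ n ih =>
    rw [pow_succ', Module.End.mul_apply,
      show k - 2 * ((n + 1 : ℕ) : ℤ) = k - 2 * n - 2 by push_cast; ring]
    exact map_monodromyFiltration_le _ (Submodule.mem_map_of_mem ih)

theorem monodromyFiltration_neg_le_map_pow (l : ℕ) :
    monodromyFiltration N (-(l : ℤ)) ≤ (monodromyFiltration N l).map (N ^ l) := by
  refine monodromyFiltration_le fun i j x hk hx => ?_
  obtain rfl : j = l + i := by omega
  rw [pow_add, Module.End.mul_apply]
  refine Submodule.mem_map_of_mem
    (pow_apply_mem_monodromyFiltration (i := l + i) (by push_cast; ring) ?_)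
  rwa [show l + i + i + 1 = i + (l + i) + 1 by omega]

theorem isMonodromyFiltration_monodromyFiltration {m : ℕ} (hN : N ^ m = 0) :
    IsMonodromyFiltration N (monodromyFiltration N) where
  le_succ k := monodromyFiltration_le fun i j x hk hx => by
    refine pow_apply_mem_monodromyFiltration (i := i + 1) (by push_cast; omega) ?_
    rw [show i + 1 + j + 1 = 1 + (i + j + 1) by omega, pow_add, Module.End.mul_apply, hx,
      map_zero]
  eq_bot := ⟨-m, fun k hk => eq_bot_iff.2 <| monodromyFiltration_le fun i j x hij _ => by
    rw [pow_eq_zero_of_le (by omega : m ≤ j) hN]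
    exact zero_mem _⟩
  eq_top := ⟨m, fun k hk => eq_top_iff.2 fun x _ => by
    refine pow_apply_mem_monodromyFiltration (i := k.toNat) (j := 0) (by push_cast; omega) ?_
    rw [pow_eq_zero_of_le (by omega : m ≤ k.toNat + 0 + 1) hN, LinearMap.zero_apply]⟩
  map_le := map_monodromyFiltration_le
  inducesIso l := by
    refine ⟨fun x hx => ?_, fun y hy => ?_, fun x _ hNx => ?_⟩
    · convert pow_apply_mem_monodromyFiltration_sub l hx using 2
      ring
    · obtain ⟨x, hx, rfl⟩ := monodromyFiltration_neg_le_map_pow l hy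
      exact ⟨x, hx, by simp⟩
    · rw [show -(l : ℤ) - 1 = -((l + 1 : ℕ) : ℤ) by push_cast; ring] at hNx
      obtain ⟨y, hy, hyx⟩ := monodromyFiltration_neg_le_map_pow (l + 1) hNx
      have hNy : N y ∈ monodromyFiltration N ((l : ℤ) - 1) := by
        convert map_monodromyFiltration_le _ (Submodule.mem_map_of_mem hy) using 2
        push_cast
        ring
      have hker : (N ^ l) (x - N y) = 0 := by
        rw [map_sub, ← Module.End.mul_apply, ← pow_succ, hyx, sub_self]
      have hsub : x - N y ∈ monodromyFiltration N ((l : ℤ) - 1) := by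
        cases l with
        | zero =>
          rw [pow_zero, Module.End.one_apply] at hker
          rw [hker]
          exact zero_mem _
        | succ l =>
          exact pow_apply_mem_monodromyFiltration (i := l) (j := 0) (by push_cast; ring) hker
      simpa using add_mem hsub hNy

end

theorem stmt_6 {R A : Type*} [Ring R] [AddCommGroup A] [Module R A]
    (N : A →ₗ[R] A) (hN : ∃ m : ℕ, 0 < m ∧ N ^ m = 0) :
    ∃! F : ℤ → Submodule R A,
      (∀ i : ℤ, F (i - 1) ≤ F i) ∧
      (∃ a : ℤ, ∀ i ≤ a, F i = ⊥) ∧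
      (∃ b : ℤ, ∀ i, b ≤ i → F i = ⊤) ∧
      (∀ i : ℤ, (F i).map N ≤ F (i - 2)) ∧
      (∀ i : ℕ, InducesIso N F i) := by
  obtain ⟨m, -, hm⟩ := hN
  have hG := isMonodromyFiltration_monodromyFiltration hm
  exact ⟨monodromyFiltration N,
    ⟨hG.le_succ, hG.eq_bot, hG.eq_top, hG.map_le, hG.inducesIso⟩,
    fun F ⟨h₁, h₂, h₃, h₄, h₅⟩ => IsMonodromyFiltration.unique ⟨h₁, h₂, h₃, h₄, h₅⟩ hG⟩
end
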